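/- arXiv:2201.10250 — 2 statements merged into one kernel-verified Lean document; each statement's English description precedes it below -/
import Mathlib

section
/- Theorem 1 (lower bound). Assume every cache is assigned at least one user, and let A = max_{λ∈[Λ]} |G_λ|. For integers x ≥ 0 define F2(λ,x) = F_bin(|G_λ|, μ_λ/|G_λ|, x) if x ≤ μ_λ − 1, and F2(λ,x) = 1 if x > μ_λ − 1. Then the average delay satisfies T̄(g) ≥ ((Λ−t)/(1+t)) · [ (t/(Λ−1)) · ( A − Σ_{x=0}^{A−1} (1/Λ) Σ_{λ=1}^{Λ} F2(λ,x) ) + (K_p/Λ) · (Λ−t−1)/(Λ−1) ]. -/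
open Finset

noncomputable section

/-- Probability weight of an activity pattern `ω` under independent Bernoulli
activities with success probabilities `p`. -/
def wgt {K : ℕ} (p : Fin K → ℝ) (ω : Fin K → Bool) : ℝ :=
  ∏ k, if ω k then p k else 1 - p k

/-- Load of cache `c` under association `g` and activity pattern `ω`:
the number of active users assigned to cache `c`. -/
def load {K Λ : ℕ} (g : Fin K → Fin Λ) (ω : Fin K → Bool) (c : Fin Λ) : ℕ :=
  ∑ k, if g k = c ∧ ω k = true then 1 else 0

/-- Decreasing rearrangement of a tuple of naturals, indexed by `ℕ`
(value `0` out of range): `sortDescN v 0` is the largest entry,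
`sortDescN v (Λ-1)` the smallest. -/
def sortDescN {Λ : ℕ} (v : Fin Λ → ℕ) (i : ℕ) : ℕ :=
  if h : i < Λ then (v ∘ Tuple.sort v) (Fin.rev ⟨i, h⟩) else 0

/-- Expectation of a real-valued functional of the activity pattern. -/
def expec {K : ℕ} (p : Fin K → ℝ) (f : (Fin K → Bool) → ℝ) : ℝ :=
  ∑ ω : Fin K → Bool, wgt p ω * f ω

/-- Average worst-case delay of association `g`:
`T̄(g) = ∑_{λ=1}^{Λ-t} E[l_λ] C(Λ-λ,t)/C(Λ,t)` (here `i = λ - 1` is 0-based). -/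
def avgDelay {K Λ : ℕ} (p : Fin K → ℝ) (g : Fin K → Fin Λ) (t : ℕ) : ℝ :=
  ∑ i ∈ Finset.range (Λ - t),
    expec p (fun ω => (sortDescN (load g ω) i : ℝ)) * ((Λ - 1 - i).choose t : ℝ) /
      (Λ.choose t : ℝ)

/-- `μ_λ`: expected number of active users assigned to cache `c`. -/
def muC {K Λ : ℕ} (p : Fin K → ℝ) (g : Fin K → Fin Λ) (c : Fin Λ) : ℝ :=
  ∑ k, if g k = c then p k else 0

/-- `σ_λ²`: variance of the number of active users assigned to cache `c`. -/
def sigma2C {K Λ : ℕ} (p : Fin K → ℝ) (g : Fin K → Fin Λ) (c : Fin Λ) : ℝ :=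
  ∑ k, if g k = c then p k * (1 - p k) else 0

/-- `|G_λ|`: the number of users assigned to cache `c`. -/
def Gcard {K Λ : ℕ} (g : Fin K → Fin Λ) (c : Fin Λ) : ℕ :=
  (Finset.univ.filter fun k => g k = c).card

/-- Binomial cumulative distribution function `F_bin(n,q,x)`. -/
def Fbin (n : ℕ) (q : ℝ) (x : ℕ) : ℝ :=
  ∑ i ∈ Finset.range (x + 1), (n.choose i : ℝ) * q ^ i * (1 - q) ^ (n - i)

theorem expec_sum {K : ℕ} (p : Fin K → ℝ) {ι : Type*} (s : Finset ι)
    (f : ι → (Fin K → Bool) → ℝ) :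
    expec p (fun ω => ∑ i ∈ s, f i ω) = ∑ i ∈ s, expec p (f i) := by
  simp only [expec, Finset.mul_sum]
  exact Finset.sum_comm

theorem wgt_nonneg {K : ℕ} {p : Fin K → ℝ} (hp : ∀ k, 0 ≤ p k ∧ p k ≤ 1)
    (ω : Fin K → Bool) : 0 ≤ wgt p ω := by
  refine Finset.prod_nonneg fun k _ => ?_
  have := hp k
  split_ifs <;> linarith

theorem expec_active {K : ℕ} (p : Fin K → ℝ) (k : Fin K) :
    expec p (fun ω => if ω k = true then 1 else 0) = p k := by
  let f : Fin K → Bool → ℝ := fun j b =>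
    (if b then p j else 1 - p j) * (if j = k then (if b = true then 1 else 0) else 1)
  have hf : ∀ ω : Fin K → Bool,
      wgt p ω * (if ω k = true then 1 else 0) = ∏ j, f j (ω j) := by
    intro ω
    simp only [f, wgt, Finset.prod_mul_distrib, Finset.prod_ite_eq', Finset.mem_univ, if_true]
  have hj : ∀ j, ∑ b, f j b = if j = k then p k else 1 := by
    intro j
    by_cases h : j = k
    · simp [f, h]
    · simp [f, h]
  have := Finset.prod_univ_sum (fun _ : Fin K => (Finset.univ : Finset Bool)) f
  rw [Fintype.piFinset_univ] at this
  simp only [expec, hf]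
  rw [← this]
  simp only [hj, Finset.prod_ite_eq', Finset.mem_univ, if_true]

theorem sum_load {K Λ : ℕ} (g : Fin K → Fin Λ) (ω : Fin K → Bool) :
    ∑ c, load g ω c = ∑ k, if ω k = true then 1 else 0 := by
  simp only [load, ite_and]
  rw [Finset.sum_comm]
  simp

theorem sum_sortDescN {Λ : ℕ} (v : Fin Λ → ℕ) :
    ∑ i ∈ Finset.range Λ, sortDescN v i = ∑ c, v c := by
  rw [Finset.sum_range]
  simp only [sortDescN, Fin.is_lt, dite_true, Fin.eta, Function.comp_apply]
  exact (Equiv.sum_comp Fin.revPerm fun i => v (Tuple.sort v i)).trans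
    (Equiv.sum_comp (Tuple.sort v) v)

theorem sortDescN_antitone {Λ : ℕ} (v : Fin Λ → ℕ) : Antitone (sortDescN v) := by
  intro i j hij
  unfold sortDescN
  split_ifs with hj hi hi
  · exact Tuple.monotone_sort v (Fin.rev_le_rev.mpr hij)
  · omega
  · exact Nat.zero_le _
  · exact le_rfl

theorem sum_range_choose_reflect (n t : ℕ) :
    ∑ i ∈ Finset.range n, (n - 1 - i).choose t = n.choose (t + 1) := by
  rw [Finset.sum_range_reflect (fun i => i.choose t) n]
  induction n with
  | zero => simp
  | succ n ih => rw [Finset.sum_range_succ, ih, Nat.choose_succ_succ, add_comm]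

theorem choose_mul_sum_le_sum_sortDescN {Λ : ℕ} (t : ℕ) (v : Fin Λ → ℕ) :
    Λ.choose (t + 1) * ∑ c, v c ≤
      Λ * ∑ i ∈ Finset.range (Λ - t), sortDescN v i * (Λ - 1 - i).choose t := by
  have hw : Antitone fun i => (Λ - 1 - i).choose t := fun i j hij =>
    Nat.choose_le_choose t (by omega)
  have h := ((sortDescN_antitone v).monovary hw).monovaryOn (Finset.range Λ : Set ℕ)
    |>.sum_mul_sum_le_card_mul_sum
  rw [sum_sortDescN, sum_range_choose_reflect, Finset.card_range, mul_comm] at h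
  refine h.trans_eq (congrArg _ (Finset.sum_subset ?_ ?_).symm)
  · exact Finset.range_mono (Nat.sub_le _ _)
  · intro i hi hi'
    simp only [Finset.mem_range] at hi hi'
    rw [Nat.choose_eq_zero_of_lt (by omega), mul_zero]

theorem expec_sum_load {K Λ : ℕ} (p : Fin K → ℝ) (g : Fin K → Fin Λ) :
    expec p (fun ω => ((∑ c, load g ω c : ℕ) : ℝ)) = ∑ k, p k := by
  simp only [sum_load, Nat.cast_sum, Nat.cast_ite, Nat.cast_one, Nat.cast_zero]
  rw [expec_sum]
  simp only [expec_active]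

theorem choose_mul_sum_le_avgDelay {K Λ t : ℕ} (ht : t ≤ Λ) {p : Fin K → ℝ}
    (hp : ∀ k, 0 ≤ p k ∧ p k ≤ 1) (g : Fin K → Fin Λ) :
    (Λ.choose (t + 1) : ℝ) * ∑ k, p k ≤ Λ * (Λ.choose t * avgDelay p g t) := by
  have hc : (Λ.choose t : ℝ) ≠ 0 := by exact_mod_cast (Nat.choose_pos ht).ne'
  have hT : (Λ.choose t : ℝ) * avgDelay p g t =
      expec p (fun ω => ∑ i ∈ Finset.range (Λ - t),
        (sortDescN (load g ω) i : ℝ) * ((Λ - 1 - i).choose t : ℝ)) := by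
    rw [expec_sum, avgDelay, Finset.mul_sum]
    refine Finset.sum_congr rfl fun i _ => ?_
    rw [mul_div_cancel₀ _ hc]
    simp only [expec, Finset.sum_mul, mul_assoc]
  rw [hT, ← expec_sum_load p g]
  simp only [expec, Finset.mul_sum (s := Finset.univ (α := Fin K → Bool))]
  refine Finset.sum_le_sum fun ω _ => ?_
  rw [mul_left_comm, mul_left_comm (Λ : ℝ)]
  refine mul_le_mul_of_nonneg_left ?_ (wgt_nonneg hp ω)
  exact_mod_cast choose_mul_sum_le_sum_sortDescN t (load g ω)

theorem mean_delay_le_avgDelay {K Λ t : ℕ} (hΛ : 0 < Λ) (ht : t ≤ Λ) {p : Fin K → ℝ}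
    (hp : ∀ k, 0 ≤ p k ∧ p k ≤ 1) (g : Fin K → Fin Λ) :
    ((Λ : ℝ) - t) / (1 + t) * ((∑ k, p k) / Λ) ≤ avgDelay p g t := by
  have hc : (0 : ℝ) < Λ.choose t := by exact_mod_cast Nat.choose_pos ht
  have hΛ' : (0 : ℝ) < Λ := by exact_mod_cast hΛ
  have hs : (Λ.choose (t + 1) : ℝ) * (t + 1) = Λ.choose t * ((Λ : ℝ) - t) := by
    rw [← Nat.cast_sub ht]
    exact_mod_cast Nat.choose_succ_right_eq Λ t
  have h := choose_mul_sum_le_avgDelay ht hp g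
  have hs' : (Λ.choose (t + 1) : ℝ) = Λ.choose t * (((Λ : ℝ) - t) / (1 + t)) := by
    rw [← mul_div_assoc, ← hs, add_comm (1 : ℝ), mul_div_cancel_right₀ _ (by positivity)]
  rw [hs', mul_assoc, mul_left_comm (Λ : ℝ)] at h
  have h' := le_of_mul_le_mul_left h hc
  rw [← mul_div_assoc, div_le_iff₀ hΛ', mul_comm (avgDelay p g t)]
  exact h'

theorem sum_binomial (n : ℕ) (q : ℝ) :
    ∑ i ∈ Finset.range (n + 1), (n.choose i : ℝ) * q ^ i * (1 - q) ^ (n - i) = 1 := by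
  simpa [bernsteinPolynomial, Polynomial.eval_finsetSum] using
    congrArg (Polynomial.eval q) (bernsteinPolynomial.sum ℝ n)

theorem sum_mul_binomial (n : ℕ) (q : ℝ) :
    ∑ i ∈ Finset.range (n + 1), (i : ℝ) * ((n.choose i : ℝ) * q ^ i * (1 - q) ^ (n - i)) =
      n * q := by
  simpa [bernsteinPolynomial, Polynomial.eval_finsetSum] using
    congrArg (Polynomial.eval q) (bernsteinPolynomial.sum_smul ℝ n)

theorem one_sub_Fbin (n : ℕ) (q : ℝ) (x : ℕ) :
    1 - Fbin n q x = ∑ i ∈ Finset.range (n + 1),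
      if x < i then (n.choose i : ℝ) * q ^ i * (1 - q) ^ (n - i) else 0 := by
  have h : Fbin n q x = ∑ i ∈ Finset.range (n + 1),
      if ¬ x < i then (n.choose i : ℝ) * q ^ i * (1 - q) ^ (n - i) else 0 := by
    rw [← Finset.sum_filter, Fbin]
    refine (Finset.sum_subset (fun i hi => ?_) fun i hi hi' => ?_).symm
    · simp only [Finset.mem_filter, Finset.mem_range] at hi ⊢
      omega
    · simp only [Finset.mem_filter, Finset.mem_range] at hi hi'
      rw [Nat.choose_eq_zero_of_lt (by omega)]
      simp
  rw [h, sub_eq_iff_eq_add, ← Finset.sum_add_distrib]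
  refine (sum_binomial n q).symm.trans (Finset.sum_congr rfl fun i _ => ?_)
  by_cases hi : x < i <;> simp only [hi, not_true, not_false_iff, if_true, if_false, add_zero,
    zero_add]

theorem Fbin_le_one (n : ℕ) {q : ℝ} (hq0 : 0 ≤ q) (hq1 : q ≤ 1) (x : ℕ) :
    Fbin n q x ≤ 1 := by
  rw [← sub_nonneg, one_sub_Fbin]
  refine Finset.sum_nonneg fun i _ => ?_
  have := sub_nonneg.mpr hq1
  split_ifs <;> positivity

theorem sum_one_sub_Fbin_le (n N : ℕ) {q : ℝ} (hq0 : 0 ≤ q) (hq1 : q ≤ 1) :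
    ∑ x ∈ Finset.range N, (1 - Fbin n q x) ≤ n * q := by
  simp only [one_sub_Fbin]
  rw [Finset.sum_comm, ← sum_mul_binomial n q]
  refine Finset.sum_le_sum fun i _ => ?_
  rw [← Finset.sum_filter, Finset.sum_const, nsmul_eq_mul]
  have := sub_nonneg.mpr hq1
  refine mul_le_mul_of_nonneg_right ?_ (by positivity)
  have hsub : (Finset.range N).filter (· < i) ⊆ Finset.range i := fun x hx => by
    simp only [Finset.mem_filter, Finset.mem_range] at hx ⊢
    exact hx.2
  exact_mod_cast (Finset.card_le_card hsub).trans_eq (Finset.card_range i)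

theorem sum_muC {K Λ : ℕ} (p : Fin K → ℝ) (g : Fin K → Fin Λ) :
    ∑ c, muC p g c = ∑ k, p k := by
  simp only [muC]
  rw [Finset.sum_comm]
  simp

theorem muC_nonneg {K Λ : ℕ} {p : Fin K → ℝ} (hp : ∀ k, 0 ≤ p k ∧ p k ≤ 1)
    (g : Fin K → Fin Λ) (c : Fin Λ) : 0 ≤ muC p g c := by
  refine Finset.sum_nonneg fun k _ => ?_
  split_ifs
  exacts [(hp k).1, le_rfl]

theorem muC_le_Gcard {K Λ : ℕ} {p : Fin K → ℝ} (hp : ∀ k, 0 ≤ p k ∧ p k ≤ 1)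
    (g : Fin K → Fin Λ) (c : Fin Λ) : muC p g c ≤ Gcard g c := by
  rw [muC, Gcard, Finset.card_filter]
  push_cast
  refine Finset.sum_le_sum fun k _ => ?_
  split_ifs
  exacts [(hp k).2, le_rfl]

theorem sum_one_sub_truncated_Fbin_le_muC {K Λ : ℕ} {p : Fin K → ℝ}
    (hp : ∀ k, 0 ≤ p k ∧ p k ≤ 1) (g : Fin K → Fin Λ) (c : Fin Λ)
    (hc : 1 ≤ Gcard g c) (N : ℕ) :
    ∑ x ∈ Finset.range N,
      (1 - if (x : ℝ) ≤ muC p g c - 1 then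
        Fbin (Gcard g c) (muC p g c / (Gcard g c : ℝ)) x else 1) ≤ muC p g c := by
  have hn : (0 : ℝ) < Gcard g c := by exact_mod_cast hc
  have hq0 : 0 ≤ muC p g c / (Gcard g c : ℝ) := div_nonneg (muC_nonneg hp g c) hn.le
  have hq1 : muC p g c / (Gcard g c : ℝ) ≤ 1 := (div_le_one hn).mpr (muC_le_Gcard hp g c)
  refine (Finset.sum_le_sum fun x _ => ?_).trans
    ((sum_one_sub_Fbin_le (Gcard g c) N hq0 hq1).trans_eq (mul_div_cancel₀ _ hn.ne'))
  have := Fbin_le_one (Gcard g c) hq0 hq1 x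
  split_ifs <;> linarith

/-- Theorem 1 (lower bound). -/
theorem theorem1_lower_bound {K Λ t : ℕ} (hΛ : 2 ≤ Λ) (ht1 : 1 ≤ t) (ht2 : t ≤ Λ - 1)
    (p : Fin K → ℝ) (hp : ∀ k, 0 ≤ p k ∧ p k ≤ 1)
    (g : Fin K → Fin Λ) (hg : ∀ c, 1 ≤ Gcard g c) :
    ((Λ : ℝ) - t) / (1 + t) *
        ((t : ℝ) / ((Λ : ℝ) - 1) *
          (((Finset.univ.sup (fun c => Gcard g c) : ℕ) : ℝ) -
            ∑ x ∈ Finset.range (Finset.univ.sup (fun c => Gcard g c)),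
              (1 / (Λ : ℝ)) *
                ∑ c : Fin Λ,
                  (if (x : ℝ) ≤ muC p g c - 1 then
                    Fbin (Gcard g c) (muC p g c / (Gcard g c : ℝ)) x
                   else 1)) +
          ((∑ k, p k) / (Λ : ℝ)) * ((Λ : ℝ) - t - 1) / ((Λ : ℝ) - 1)) ≤
      avgDelay p g t := by
  have hΛ0 : (0 : ℝ) < Λ := by exact_mod_cast (by omega : 0 < Λ)
  have hΛ1 : (0 : ℝ) < (Λ : ℝ) - 1 := by
    have : (2 : ℝ) ≤ Λ := by exact_mod_cast hΛ
    linarith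
  have htΛ : (0 : ℝ) ≤ (Λ : ℝ) - t := by
    have : (t : ℝ) ≤ Λ := by exact_mod_cast (by omega : t ≤ Λ)
    linarith
  refine le_trans ?_ (mean_delay_le_avgDelay (by omega) (by omega) hp g)
  refine mul_le_mul_of_nonneg_left ?_ (by positivity)
  set A := Finset.univ.sup (fun c => Gcard g c)
  have hA : ((A : ℕ) : ℝ) - ∑ x ∈ Finset.range A, (1 / (Λ : ℝ)) *
      ∑ c : Fin Λ, (if (x : ℝ) ≤ muC p g c - 1 then
        Fbin (Gcard g c) (muC p g c / (Gcard g c : ℝ)) x else 1) ≤ (∑ k, p k) / Λ := by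
    have h := Finset.sum_le_sum fun c (_ : c ∈ Finset.univ) =>
      sum_one_sub_truncated_Fbin_le_muC hp g c (hg c) A
    rw [sum_muC, Finset.sum_comm] at h
    simp only [Finset.sum_sub_distrib, Finset.sum_const, Finset.card_univ, Fintype.card_fin,
      Finset.card_range, nsmul_eq_mul, mul_one] at h
    rw [← Finset.mul_sum, le_div_iff₀ hΛ0, sub_mul, one_div_mul_eq_div,
      div_mul_cancel₀ _ hΛ0.ne', mul_comm]
    linarith
  calc _ ≤ (t : ℝ) / ((Λ : ℝ) - 1) * ((∑ k, p k) / Λ) +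
        ((∑ k, p k) / (Λ : ℝ)) * ((Λ : ℝ) - t - 1) / ((Λ : ℝ) - 1) := by gcongr
    _ = (∑ k, p k) / Λ := by
      field_simp
      ring

end
end

section
/- Lemma 1. Suppose all users have the same activity level p_1 = p_2 = … = p_K = p ∈ [0,1] and K = I·Λ for an integer I. Then any uniform association g* (one with |g*⁻¹(λ)| = I for every cache λ) minimizes the average delay: T̄(g*) ≤ T̄(g) for every user-to-cache association g. -/
open Finset

noncomputable section

/-- Sum over all `m`-subsets of caches of the maximal entry in the subset. -/
def subsetMaxSum {n : ℕ} (m : ℕ) (v : Fin n → ℕ) : ℕ :=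
  ∑ S ∈ powersetCard m (univ : Finset (Fin n)), S.sup v

/-- Number of active users in a set of users. -/
def activeCount {K : ℕ} (S : Finset (Fin K)) (ω : Fin K → Bool) : ℕ :=
  ∑ k ∈ S, if ω k = true then 1 else 0

theorem subsetMaxSum_comp_perm {n : ℕ} (m : ℕ) (v : Fin n → ℕ) (σ : Equiv.Perm (Fin n)) :
    subsetMaxSum m (v ∘ σ) = subsetMaxSum m v := by
  unfold subsetMaxSum
  have h : powersetCard m (univ : Finset (Fin n)) =
      (powersetCard m (univ : Finset (Fin n))).map (mapEmbedding σ.toEmbedding).toEmbedding := by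
    rw [← powersetCard_map, map_univ_equiv]
  conv_rhs => rw [h, sum_map]
  refine sum_congr rfl fun S _ => ?_
  simp [mapEmbedding_apply, sup_map]

theorem subsetMaxSum_of_monotone (t : ℕ) : ∀ {n : ℕ} (v : Fin n → ℕ), Monotone v →
    subsetMaxSum (t + 1) v = ∑ j : Fin n, v j * (j : ℕ).choose t
  | 0, v, _ => by simp [subsetMaxSum]
  | n + 1, v, hv => by
    have ih := subsetMaxSum_of_monotone t (fun j : Fin n => v j.castSucc)
      (fun i j hij => hv (Fin.castSucc_le_castSucc_iff.2 hij))
    rw [Fin.sum_univ_castSucc]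
    simp only [Fin.val_castSucc, Fin.val_last]
    rw [← ih]
    unfold subsetMaxSum
    have hlast : Fin.last n ∉ (univ : Finset (Fin n)).map Fin.castSuccEmb := by
      simp [Fin.castSucc_ne_last]
    have hU : (univ : Finset (Fin (n + 1))) =
        insert (Fin.last n) ((univ : Finset (Fin n)).map Fin.castSuccEmb) := by
      ext k
      induction k using Fin.lastCases <;> simp
    rw [hU, powersetCard_succ_insert hlast, sum_union]
    · congr 1
      · rw [powersetCard_map, sum_map]
        refine sum_congr rfl fun S _ => ?_
        simp [mapEmbedding_apply, sup_map]
        rfl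
      · rw [sum_image]
        · have : ∀ S ∈ powersetCard t ((univ : Finset (Fin n)).map Fin.castSuccEmb),
              (insert (Fin.last n) S).sup v = v (Fin.last n) := by
            intro S _
            rw [sup_insert]
            exact sup_eq_left.2 (Finset.sup_le fun k _ => hv (Fin.le_last k))
          rw [sum_congr rfl this]
          simp [mul_comm]
        · intro S hS T hT hST
          have h1 : Fin.last n ∉ S := fun h => hlast ((mem_powersetCard.1 hS).1 h)
          have h2 : Fin.last n ∉ T := fun h => hlast ((mem_powersetCard.1 hT).1 h)
          rw [← erase_insert h1, ← erase_insert h2]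
          exact congrArg (fun U => erase U (Fin.last n)) hST
    · rw [disjoint_left]
      intro S hS hS'
      obtain ⟨T, _, rfl⟩ := mem_image.1 hS'
      exact hlast ((mem_powersetCard.1 hS).1 (mem_insert_self _ _))

theorem sum_sortDescN_mul_choose {n : ℕ} (t : ℕ) (v : Fin n → ℕ) :
    ∑ i ∈ range (n - t), sortDescN v i * (n - 1 - i).choose t = subsetMaxSum (t + 1) v := by
  rw [← subsetMaxSum_comp_perm _ v (Tuple.sort v),
    subsetMaxSum_of_monotone t _ (Tuple.monotone_sort v)]
  have h1 : ∑ i ∈ range (n - t), sortDescN v i * (n - 1 - i).choose t =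
      ∑ i ∈ range n, sortDescN v i * (n - 1 - i).choose t := by
    apply sum_subset (range_subset_range.2 (Nat.sub_le _ _))
    intro i hi hi'
    rw [mem_range] at hi hi'
    rw [Nat.choose_eq_zero_of_lt (by omega), mul_zero]
  rw [h1, sum_range]
  refine Fintype.sum_equiv Fin.revPerm _ _ fun i => ?_
  have : n - 1 - (i : ℕ) = n - (i + 1) := by omega
  simp [sortDescN, this]

theorem avgDelay_eq {K Λ : ℕ} (p : Fin K → ℝ) (g : Fin K → Fin Λ) (t : ℕ) :
    avgDelay p g t =
      expec p (fun ω => (subsetMaxSum (t + 1) (load g ω) : ℝ)) / (Λ.choose t : ℝ) := by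
  unfold avgDelay
  rw [← sum_div]
  congr 1
  unfold expec
  simp_rw [sum_mul]
  rw [sum_comm]
  refine sum_congr rfl fun ω _ => ?_
  rw [← sum_sortDescN_mul_choose]
  push_cast
  rw [mul_sum]
  exact sum_congr rfl fun i _ => by ring

theorem load_eq_activeCount {K Λ : ℕ} (g : Fin K → Fin Λ) (ω : Fin K → Bool) (c : Fin Λ) :
    load g ω c = activeCount (univ.filter fun k => g k = c) ω := by
  unfold load activeCount
  rw [sum_filter]
  refine sum_congr rfl fun k _ => ?_
  by_cases h : g k = c <;> simp [h]

theorem activeCount_comp_perm {K : ℕ} (S T : Finset (Fin K)) (ω : Fin K → Bool)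
    (τ : Equiv.Perm (Fin K)) (h : S.map τ.toEmbedding = T) :
    activeCount S (ω ∘ τ) = activeCount T ω := by
  subst h
  simp only [activeCount, sum_map, Function.comp_apply, Equiv.coe_toEmbedding]

theorem expec_comp_perm {K : ℕ} (p : ℝ) (f : (Fin K → Bool) → ℝ) (τ : Equiv.Perm (Fin K)) :
    expec (fun _ => p) (fun ω => f (ω ∘ τ)) = expec (fun _ => p) f := by
  unfold expec
  refine Fintype.sum_equiv (Equiv.arrowCongr τ.symm (Equiv.refl Bool)) _ _ fun ω => ?_
  have h : (Equiv.arrowCongr τ.symm (Equiv.refl Bool)) ω = ω ∘ τ := by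
    ext k; simp
  rw [h]
  congr 1
  unfold wgt
  exact (Equiv.prod_comp τ fun k => if ω k = true then p else 1 - p).symm

theorem expec_mono {K : ℕ} {p : ℝ} (hp : 0 ≤ p ∧ p ≤ 1) {f f' : (Fin K → Bool) → ℝ}
    (h : ∀ ω, f ω ≤ f' ω) : expec (fun _ => p) f ≤ expec (fun _ => p) f' := by
  refine sum_le_sum fun ω _ => mul_le_mul_of_nonneg_left (h ω) (prod_nonneg fun k _ => ?_)
  split_ifs
  · exact hp.1
  · linarith [hp.2]

theorem expec_add {K : ℕ} (p : Fin K → ℝ) (f f' : (Fin K → Bool) → ℝ) :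
    expec p (fun ω => f ω + f' ω) = expec p f + expec p f' := by
  simp [expec, mul_add, sum_add_distrib]

theorem avgDelay_comp_perm {K Λ : ℕ} (p : ℝ) (g : Fin K → Fin Λ) (t : ℕ)
    (σ : Equiv.Perm (Fin K)) :
    avgDelay (fun _ => p) (g ∘ σ) t = avgDelay (fun _ => p) g t := by
  rw [avgDelay_eq, avgDelay_eq, ← expec_comp_perm p _ σ]
  congr 2
  ext ω
  congr 2
  ext c
  exact Equiv.sum_comp σ fun k => if g k = c ∧ ω k = true then 1 else 0

/-- Two associations with the same occupancy numbers differ by a permutation of users. -/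
theorem exists_perm_of_Gcard_eq {K Λ : ℕ} (g g' : Fin K → Fin Λ)
    (h : ∀ c, Gcard g c = Gcard g' c) : ∃ σ : Equiv.Perm (Fin K), g' ∘ σ = g := by
  have e : ∀ c, Nonempty ({k // g k = c} ≃ {k // g' k = c}) := fun c =>
    ⟨Fintype.equivOfCardEq (by simpa [Gcard, Fintype.card_subtype] using h c)⟩
  exact ⟨Equiv.ofFiberEquiv fun c => (e c).some, funext fun k => Equiv.ofFiberEquiv_map _ k⟩

/-- Disjoint sets of equal size are exchanged by some permutation fixing all other points. -/
theorem exists_perm_exchange {α : Type*} [DecidableEq α] (A B : Finset α) (hAB : Disjoint A B)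
    (hc : A.card = B.card) : ∃ τ : Equiv.Perm α, A.map τ.toEmbedding = B ∧
      B.map τ.toEmbedding = A ∧ ∀ k, k ∉ A → k ∉ B → τ k = k := by
  induction A using Finset.induction_on generalizing B with
  | empty =>
    obtain rfl : B = ∅ := card_eq_zero.1 (by simpa using hc.symm)
    exact ⟨1, by simp⟩
  | insert a A ha ih =>
    rw [card_insert_of_notMem ha] at hc
    obtain ⟨b, hb⟩ : B.Nonempty := card_pos.1 (by omega)
    rw [disjoint_insert_left] at hAB
    have hbA : b ∉ A := fun h => disjoint_left.1 hAB.2 h hb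
    have hab : a ≠ b := fun h => hAB.1 (h ▸ hb)
    obtain ⟨τ, h1, h2, h3⟩ := ih (B.erase b) (hAB.2.mono_right (erase_subset _ _))
      (by rw [card_erase_of_mem hb]; omega)
    have hτa : τ a = a := h3 a ha fun h => hAB.1 (mem_of_mem_erase h)
    have hτb : τ b = b := h3 b hbA (notMem_erase _ _)
    have hfix : ∀ k, k ≠ a → k ≠ b → (Equiv.swap a b * τ) k = τ k := by
      intro k hka hkb
      rw [Equiv.Perm.mul_apply, Equiv.swap_apply_of_ne_of_ne]
      · exact fun h => hka (τ.injective (h.trans hτa.symm))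
      · exact fun h => hkb (τ.injective (h.trans hτb.symm))
    have hmap : ∀ S : Finset α, a ∉ S → b ∉ S →
        S.map (Equiv.swap a b * τ).toEmbedding = S.map τ.toEmbedding := by
      intro S hSa hSb
      rw [map_eq_image, map_eq_image]
      exact image_congr fun k hk => hfix k (fun h => hSa (h ▸ hk)) (fun h => hSb (h ▸ hk))
    refine ⟨Equiv.swap a b * τ, ?_, ?_, ?_⟩
    · rw [map_insert, hmap A ha hbA, h1]
      simp [hτa, insert_erase hb]
    · conv_lhs => rw [← insert_erase hb]
      rw [map_insert, hmap _ (fun h => hAB.1 (mem_of_mem_erase h)) (notMem_erase _ _), h2]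
      simp [hτb]
    · intro k hk hkB
      rw [mem_insert, not_or] at hk
      rw [hfix k hk.1 (fun h => hkB (h ▸ hb))]
      exact h3 k hk.2 fun h => hkB (mem_of_mem_erase h)

theorem sup_eq_max_pair {n : ℕ} (S : Finset (Fin n)) (v : Fin n → ℕ) (a b : Fin n) :
    S.sup v = max (((S.erase a).erase b).sup v)
      (max (if a ∈ S then v a else 0) (if b ∈ S then v b else 0)) := by
  apply le_antisymm
  · refine Finset.sup_le fun c hc => ?_
    by_cases hca : c = a
    · subst hca; simp [hc]
    by_cases hcb : c = b
    · subst hcb; simp [hc]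
    exact le_max_of_le_left (le_sup (f := v) (by simp [hca, hcb, hc]))
  · refine max_le (sup_mono ((erase_subset _ _).trans (erase_subset _ _))) (max_le ?_ ?_)
    · split_ifs with h
      · exact le_sup (f := v) h
      · exact Nat.zero_le _
    · split_ifs with h
      · exact le_sup (f := v) h
      · exact Nat.zero_le _

theorem max_pair_exchange (M x y z : ℕ) :
    max M (max (x + z) (y + 1)) + max M (max (y + z) (x + 1)) ≤
      max M (max (x + z + 1) y) + max M (max (y + z + 1) x) := by
  omega

theorem max_single_exchange (M x y z : ℕ) :
    max M (x + z) + max M (y + 1) + (max M (y + z) + max M (x + 1)) ≤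
      max M (x + z + 1) + max M y + (max M (y + z + 1) + max M x) := by
  omega

/-- Exchange inequality for load vectors that agree outside two caches `a` and `b`. -/
theorem subsetMaxSum_exchange {n : ℕ} (m : ℕ) (u v u' v' : Fin n → ℕ) (a b : Fin n)
    (x y z : ℕ)
    (hua : u a = x + z + 1) (hub : u b = y) (hua' : u' a = y + z + 1) (hub' : u' b = x)
    (hva : v a = x + z) (hvb : v b = y + 1) (hva' : v' a = y + z) (hvb' : v' b = x + 1)
    (huu : ∀ c, c ≠ a → c ≠ b → u' c = u c) (hvu : ∀ c, c ≠ a → c ≠ b → v c = u c)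
    (hvu' : ∀ c, c ≠ a → c ≠ b → v' c = u c) :
    subsetMaxSum m v + subsetMaxSum m v' ≤ subsetMaxSum m u + subsetMaxSum m u' := by
  have key : subsetMaxSum m v + subsetMaxSum m (v ∘ Equiv.swap a b) +
        (subsetMaxSum m v' + subsetMaxSum m (v' ∘ Equiv.swap a b)) ≤
      subsetMaxSum m u + subsetMaxSum m (u ∘ Equiv.swap a b) +
        (subsetMaxSum m u' + subsetMaxSum m (u' ∘ Equiv.swap a b)) := by
    unfold subsetMaxSum
    simp only [← sum_add_distrib]
    refine sum_le_sum fun S _ => ?_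
    have hrest : ∀ w : Fin n → ℕ, (∀ c, c ≠ a → c ≠ b → w c = u c) →
        ((S.erase a).erase b).sup w = ((S.erase a).erase b).sup u := fun w hw =>
      sup_congr rfl fun c hc => by
        simp only [mem_erase] at hc
        exact hw c hc.2.1 hc.1
    have hswap : ∀ w : Fin n → ℕ, (∀ c, c ≠ a → c ≠ b → w c = u c) →
        ∀ c, c ≠ a → c ≠ b → (w ∘ Equiv.swap a b) c = u c := fun w hw c hca hcb => by
      simp [Equiv.swap_apply_of_ne_of_ne hca hcb, hw c hca hcb]
    have huself : ∀ c, c ≠ a → c ≠ b → u c = u c := fun _ _ _ => rfl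
    simp only [sup_eq_max_pair S _ a b, hrest _ huu, hrest _ hvu, hrest _ hvu',
      hrest _ (hswap _ huu), hrest _ (hswap _ hvu), hrest _ (hswap _ hvu'),
      hrest _ (hswap _ huself), Function.comp_apply, Equiv.swap_apply_left,
      Equiv.swap_apply_right, hua, hub, hua', hub', hva, hvb, hva', hvb']
    generalize ((S.erase a).erase b).sup u = M
    have hpair := max_pair_exchange M x y z
    have hsingle := max_single_exchange M x y z
    by_cases ha : a ∈ S <;> by_cases hb : b ∈ S <;>
      simp only [ha, hb, if_true, if_false, Nat.max_zero, Nat.zero_max]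
    · rw [max_comm (y + 1) (x + z), max_comm (x + 1) (y + z), max_comm y (x + z + 1),
        max_comm x (y + z + 1)]
      linarith
    · linarith
    · linarith
    · exact le_rfl
  simp only [subsetMaxSum_comp_perm] at key
  omega

/-- Moving a user from a cache to another one with strictly fewer users does not increase
the average delay. -/
theorem avgDelay_update_le {K Λ : ℕ} (t : ℕ) {p : ℝ} (hp : 0 ≤ p ∧ p ≤ 1) (g : Fin K → Fin Λ)
    (k₀ : Fin K) (b : Fin Λ) (hlt : Gcard g b < Gcard g (g k₀)) :
    avgDelay (fun _ => p) (Function.update g k₀ b) t ≤ avgDelay (fun _ => p) g t := by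
  have hab : g k₀ ≠ b := by
    intro h; rw [h] at hlt; exact lt_irrefl _ hlt
  set a := g k₀ with ha
  set g' := Function.update g k₀ b with hg'
  set R : Finset (Fin K) := (univ.filter fun k => g k = a).erase k₀ with hR
  set B : Finset (Fin K) := univ.filter fun k => g k = b with hB
  have hk₀ : k₀ ∈ univ.filter fun k => g k = a := by simp [ha]
  have hk₀B : k₀ ∉ B := by simpa [hB] using hab
  have hRB : B.card ≤ R.card := by
    rw [hR, card_erase_of_mem hk₀]
    have : B.card < (univ.filter fun k => g k = a).card := hlt
    omega
  obtain ⟨A, hAR, hAc⟩ := exists_subset_card_eq hRB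
  have hAB : Disjoint A B := by
    rw [disjoint_left]
    intro k hkA hkB
    have h1 := hAR hkA
    simp only [hR, hB, mem_erase, mem_filter, mem_univ, true_and] at h1 hkB
    exact hab (h1.2.symm.trans hkB)
  obtain ⟨τ, hτA, hτB, hτ⟩ := exists_perm_exchange A B hAB hAc
  have hτk₀ : τ k₀ = k₀ := hτ k₀ (fun h => by simpa [hR] using hAR h) hk₀B
  have hfix : ∀ S : Finset (Fin K), Disjoint S A → Disjoint S B → ∀ ω,
      activeCount S (ω ∘ τ) = activeCount S ω := by
    intro S hSA hSB ω
    refine sum_congr rfl fun k hk => ?_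
    rw [Function.comp_apply, hτ k (disjoint_left.1 hSA hk) (disjoint_left.1 hSB hk)]
  have hRsplit : ∀ ω, activeCount R ω = activeCount A ω + activeCount (R \ A) ω := fun ω => by
    rw [add_comm]; exact (sum_sdiff hAR).symm
  have hga : ∀ ω, load g ω a = activeCount R ω + if ω k₀ = true then 1 else 0 := fun ω => by
    rw [load_eq_activeCount]; exact (sum_erase_add _ _ hk₀).symm
  have hgb : ∀ ω, load g ω b = activeCount B ω := fun ω => load_eq_activeCount g ω b
  have hga' : ∀ ω, load g' ω a = activeCount R ω := fun ω => by
    rw [load_eq_activeCount]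
    congr 1
    ext k
    by_cases hk : k = k₀
    · subst hk; simp [hg', hR, hab.symm]
    · simp [hg', hR, hk]
  have hgb' : ∀ ω, load g' ω b = activeCount B ω + if ω k₀ = true then 1 else 0 := fun ω => by
    have : (univ.filter fun k => g' k = b) = insert k₀ B := by
      ext k
      by_cases hk : k = k₀
      · subst hk; simp [hg']
      · simp [hg', hB, hk]
    rw [load_eq_activeCount, this, add_comm]
    exact sum_insert hk₀B
  have hgc : ∀ ω c, c ≠ a → c ≠ b → load g' ω c = load g ω c := by
    intro ω c hca hcb
    rw [load_eq_activeCount, load_eq_activeCount]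
    congr 1
    ext k
    by_cases hk : k = k₀
    · subst hk; simp [hg', hcb.symm, ← ha, hca.symm]
    · simp [hg', hk]
  have hgτ : ∀ ω c, c ≠ a → c ≠ b → load g (ω ∘ τ) c = load g ω c := by
    intro ω c hca hcb
    rw [load_eq_activeCount, load_eq_activeCount]
    refine hfix _ (disjoint_left.2 fun k hk hkA => ?_) (disjoint_left.2 fun k hk hkB => ?_) ω
    · have h1 := hAR hkA
      simp only [hR, mem_erase, mem_filter, mem_univ, true_and] at h1 hk
      exact hca (hk.symm.trans h1.2)
    · simp only [hB, mem_filter, mem_univ, true_and] at hk hkB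
      exact hcb (hk.symm.trans hkB)
  have hpt : ∀ ω, subsetMaxSum (t + 1) (load g' ω) + subsetMaxSum (t + 1) (load g' (ω ∘ τ)) ≤
      subsetMaxSum (t + 1) (load g ω) + subsetMaxSum (t + 1) (load g (ω ∘ τ)) := by
    intro ω
    by_cases hω : ω k₀ = true
    · have hz : activeCount (R \ A) (ω ∘ τ) = activeCount (R \ A) ω := by
        refine hfix _ sdiff_disjoint (disjoint_left.2 fun k hk hkB => ?_) ω
        simp only [hR, hB, mem_sdiff, mem_erase, mem_filter, mem_univ, true_and] at hk hkB
        exact hab (hk.1.2.symm.trans hkB)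
      have hx := activeCount_comp_perm A B ω τ hτA
      have hy := activeCount_comp_perm B A ω τ hτB
      refine subsetMaxSum_exchange (t + 1) _ _ _ _ a b (activeCount A ω) (activeCount B ω)
        (activeCount (R \ A) ω) ?_ ?_ ?_ ?_ ?_ ?_ ?_ ?_ (hgτ ω) (hgc ω)
        (fun c hca hcb => (hgc _ c hca hcb).trans (hgτ ω c hca hcb)) <;>
        simp [hga, hgb, hga', hgb', hRsplit, hx, hy, hz, hτk₀, hω]
    · have hload : ∀ ω' : Fin K → Bool, ω' k₀ ≠ true → load g' ω' = load g ω' := by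
        intro ω' h
        ext c
        by_cases hca : c = a
        · subst hca; simp [hga, hga', h]
        by_cases hcb : c = b
        · subst hcb; simp [hgb, hgb', h]
        exact hgc ω' c hca hcb
      rw [hload ω hω, hload (ω ∘ τ) (by simpa [hτk₀] using hω)]
  rw [avgDelay_eq, avgDelay_eq]
  refine div_le_div_of_nonneg_right ?_ (Nat.cast_nonneg _)
  have hE := expec_mono hp (f := fun ω => (subsetMaxSum (t + 1) (load g' ω) : ℝ) +
      (subsetMaxSum (t + 1) (load g' (ω ∘ τ)) : ℝ)) (f' := fun ω =>
      (subsetMaxSum (t + 1) (load g ω) : ℝ) + (subsetMaxSum (t + 1) (load g (ω ∘ τ)) : ℝ))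
      (fun ω => by exact_mod_cast hpt ω)
  rw [expec_add, expec_add,
    expec_comp_perm p (fun ω => (subsetMaxSum (t + 1) (load g' ω) : ℝ)) τ,
    expec_comp_perm p (fun ω => (subsetMaxSum (t + 1) (load g ω) : ℝ)) τ] at hE
  linarith

theorem sum_Gcard {K Λ : ℕ} (g : Fin K → Fin Λ) : ∑ c, Gcard g c = K := by
  have := card_eq_sum_card_fiberwise (f := g) (s := univ) (t := univ) (by simp)
  simpa [Gcard] using this.symm

theorem Gcard_update_add {K Λ : ℕ} (g : Fin K → Fin Λ) (k₀ : Fin K) (b c : Fin Λ) :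
    Gcard (Function.update g k₀ b) c + (if g k₀ = c then 1 else 0) =
      Gcard g c + if b = c then 1 else 0 := by
  simp only [Gcard, card_filter]
  rw [← sum_erase_add _ _ (mem_univ k₀),
    ← sum_erase_add (a := k₀) univ (fun k => if g k = c then 1 else 0) (mem_univ k₀)]
  rw [sum_congr rfl (g := fun k => if g k = c then 1 else 0) fun k hk => by
    rw [Function.update_of_ne (ne_of_mem_erase hk)]]
  simp only [Function.update_self]
  omega

/-- Lemma 1: with uniform activity level `p` and `K = I·Λ`, any uniform association
(`I` users per cache) minimizes the average delay. -/
theorem lemma1_uniform_optimal {K Λ t I : ℕ} (hΛ : 2 ≤ Λ) (ht1 : 1 ≤ t) (ht2 : t ≤ Λ - 1)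
    (hK : K = I * Λ) (p : ℝ) (hp : 0 ≤ p ∧ p ≤ 1)
    (gstar : Fin K → Fin Λ) (hstar : ∀ c, Gcard gstar c = I) :
    ∀ g : Fin K → Fin Λ,
      avgDelay (fun _ => p) gstar t ≤ avgDelay (fun _ => p) g t := by
  intro g
  induction hN : ∑ c, (Gcard g c - I) using Nat.strong_induction_on generalizing g with
  | _ N ih =>
    subst hN
    have hsum : ∑ c, Gcard g c = ∑ _c : Fin Λ, I := by
      rw [sum_Gcard, hK]; simp [mul_comm]
    by_cases hex : ∃ a, I < Gcard g a
    · obtain ⟨a, ha⟩ := hex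
      obtain ⟨b, hb⟩ : ∃ b, Gcard g b < I := by
        by_contra! hge
        exact absurd hsum (sum_lt_sum (fun c _ => hge c) ⟨a, mem_univ _, ha⟩).ne'
      obtain ⟨k₀, hk₀⟩ : (univ.filter fun k => g k = a).Nonempty :=
        card_pos.1 (lt_of_le_of_lt (Nat.zero_le _) ha)
      simp only [mem_filter, mem_univ, true_and] at hk₀
      subst hk₀
      refine (ih _ ?_ (Function.update g k₀ b) rfl).trans
        (avgDelay_update_le t hp g k₀ b (hb.trans ha))
      have hab : b ≠ g k₀ := by
        rintro rfl; omega
      refine sum_lt_sum (fun c _ => ?_) ⟨g k₀, mem_univ _, ?_⟩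
      · have h := Gcard_update_add g k₀ b c
        by_cases hbc : b = c
        · subst hbc
          simp only [hab.symm, if_true, if_false] at h
          omega
        · simp only [hbc, if_false] at h
          omega
      · have h := Gcard_update_add g k₀ b (g k₀)
        simp only [hab, if_true, if_false] at h
        omega
    · push Not at hex
      have heq : ∀ c, Gcard g c = I := fun c =>
        (sum_eq_sum_iff_of_le fun c _ => hex c).1 hsum c (mem_univ c)
      obtain ⟨σ, hσ⟩ := exists_perm_of_Gcard_eq gstar g fun c => (hstar c).trans (heq c).symm
      rw [← hσ, avgDelay_comp_perm]

end
end
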